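/- Let 1 ≤ N ≤ p with p > 1, let q > 0, and let h : ℝ^N → ℝ be continuous, nonnegative and not identically zero. If u : ℝ^N → ℝ is a nonnegative C¹ function satisfying ∫_{ℝ^N} |∇u(x)|^{p−2}⟨∇u(x), ∇φ(x)⟩ dx ≥ ∫_{ℝ^N} h(x) u(x)^q φ(x) dx for every nonnegative C^∞ compactly supported φ : ℝ^N → ℝ, then u ≡ 0. -/

import Mathlib

open MeasureTheory Metric
open scoped RealInnerProductSpace

/-- Extension of the distributional inequality from smooth to `C¹` test functions. -/
lemma weak_C1 {E : Type*} [NormedAddCommGroup E] [InnerProductSpace ℝ E] [FiniteDimensional ℝ E]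
    [MeasurableSpace E] [BorelSpace E]
    (A : E → E) (hA : Continuous A)
    (H : ∀ φ : E → ℝ, ContDiff ℝ (⊤ : ℕ∞) φ → HasCompactSupport φ → (∀ x, 0 ≤ φ x) →
      0 ≤ ∫ x, fderiv ℝ φ x (A x))
    (φ : E → ℝ) (h1 : ContDiff ℝ 1 φ) (h2 : HasCompactSupport φ) (h3 : ∀ x, 0 ≤ φ x) :
    0 ≤ ∫ x, fderiv ℝ φ x (A x) := by
  have hF : Continuous (fderiv ℝ φ) := h1.continuous_fderiv one_ne_zero
  have hFc : HasCompactSupport (fderiv ℝ φ) := h2.fderiv (𝕜 := ℝ)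
  have hFu : UniformContinuous (fderiv ℝ φ) := hFc.uniformContinuous_of_continuous hF
  obtain ⟨R, hR⟩ := hFc.isCompact.isBounded.subset_closedBall (0 : E)
  have hzero : ∀ y, R < ‖y‖ → fderiv ℝ φ y = 0 := by
    intro y hy
    by_contra hne
    have := hR (subset_tsupport _ hne)
    rw [mem_closedBall_zero_iff] at this
    linarith
  set K : Set E := closedBall 0 (R + 1) with hK
  have hKc : IsCompact K := isCompact_closedBall _ _
  have hAK : IntegrableOn (fun x => ‖A x‖) K := hA.norm.continuousOn.integrableOn_compact hKc
  set I := ∫ x in K, ‖A x‖ with hI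
  have hI0 : 0 ≤ I := integral_nonneg fun _ => norm_nonneg _
  have key : ∀ ε > 0, - (ε * I) ≤ ∫ x, fderiv ℝ φ x (A x) := by
    intro ε hε
    obtain ⟨δ, hδ, hδε⟩ := Metric.uniformContinuous_iff.1 hFu ε hε
    set r := min δ 1 with hr
    have hr0 : 0 < r := lt_min hδ one_pos
    let ρ : ContDiffBump (0 : E) := ⟨r / 2, r, half_pos hr0, half_lt_self hr0⟩
    have hρr : ρ.rOut = r := rfl
    let ψ : E → ℝ := convolution (ρ.normed volume) φ (ContinuousLinearMap.lsmul ℝ ℝ) volume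
    have hψ1 : ContDiff ℝ (⊤ : ℕ∞) ψ :=
      ρ.hasCompactSupport_normed.contDiff_convolution_left _ ρ.contDiff_normed
        h1.continuous.locallyIntegrable
    have hψ2 : HasCompactSupport ψ := ρ.hasCompactSupport_normed.convolution _ h2
    have hψ3 : ∀ x, 0 ≤ ψ x := by
      intro x
      apply integral_nonneg
      intro y
      simpa using mul_nonneg (ρ.nonneg_normed y) (h3 _)
    have hfd : ∀ x, fderiv ℝ ψ x = convolution (ρ.normed volume) (fderiv ℝ φ)
        (ContinuousLinearMap.lsmul ℝ ℝ) volume x := by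
      intro x
      have := h2.hasFDerivAt_convolution_right (ContinuousLinearMap.lsmul ℝ ℝ) (μ := volume)
        (f := ρ.normed volume) ρ.continuous_normed.locallyIntegrable h1 x
      rw [this.fderiv]
      rfl
    have hd1 : ∀ x, dist (fderiv ℝ ψ x) (fderiv ℝ φ x) ≤ ε := by
      intro x
      rw [hfd]
      refine ρ.dist_normed_convolution_le hF.aestronglyMeasurable fun y hy => ?_
      exact (hδε (lt_of_lt_of_le hy (by rw [hρr]; exact min_le_left _ _))).le
    have hd2 : ∀ x, x ∉ K → fderiv ℝ ψ x = 0 := by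
      intro x hx
      have hx' : R + 1 < ‖x‖ := by simpa [hK] using hx
      have hx0 : fderiv ℝ φ x = 0 := hzero x (by linarith)
      have : dist (fderiv ℝ ψ x) (fderiv ℝ φ x) ≤ 0 := by
        rw [hfd]
        refine ρ.dist_normed_convolution_le hF.aestronglyMeasurable fun y hy => ?_
        have hy1 : dist y x < 1 := lt_of_lt_of_le hy (by rw [hρr]; exact min_le_right _ _)
        rw [hx0, hzero y, dist_self]
        have := norm_sub_norm_le x y
        rw [dist_comm, dist_eq_norm] at hy1
        linarith
      rw [← hx0]
      exact dist_le_zero.1 this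
    have i1 : Integrable (fun x => fderiv ℝ φ x (A x)) := by
      refine (hF.clm_apply hA).integrable_of_hasCompactSupport ?_
      exact hFc.mono fun x hx h0 => hx (by simp only [h0]; rfl)
    have i2 : Integrable (fun x => fderiv ℝ ψ x (A x)) := by
      refine ((hψ1.continuous_fderiv (by simp)).clm_apply hA).integrable_of_hasCompactSupport ?_
      exact (hψ2.fderiv (𝕜 := ℝ)).mono fun x hx h0 => hx (by simp only [h0]; rfl)
    have hle : ∫ x, (fderiv ℝ ψ x (A x) - fderiv ℝ φ x (A x)) ≤ ε * I := by
      have : ε * I = ∫ x, K.indicator (fun x => ε * ‖A x‖) x := by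
        rw [integral_indicator hKc.measurableSet, integral_const_mul]
      rw [this]
      refine integral_mono (i2.sub i1)
        ((integrable_indicator_iff hKc.measurableSet).2 (hAK.const_mul ε)) fun x => ?_
      by_cases hx : x ∈ K
      · simp only [Set.indicator_of_mem hx]
        calc fderiv ℝ ψ x (A x) - fderiv ℝ φ x (A x)
            = (fderiv ℝ ψ x - fderiv ℝ φ x) (A x) := rfl
          _ ≤ ‖(fderiv ℝ ψ x - fderiv ℝ φ x) (A x)‖ := Real.le_norm_self _
          _ ≤ ‖fderiv ℝ ψ x - fderiv ℝ φ x‖ * ‖A x‖ := ContinuousLinearMap.le_opNorm _ _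
          _ ≤ ε * ‖A x‖ := by
            gcongr
            rw [← dist_eq_norm]; exact hd1 x
      · have hx' : R + 1 < ‖x‖ := by simpa [hK] using hx
        simp [Set.indicator_of_notMem hx, hd2 x hx, hzero x (by linarith)]
    rw [integral_sub i2 i1] at hle
    have := H ψ hψ1 hψ2 hψ3
    linarith
  by_contra hneg
  push Not at hneg
  set J := ∫ x, fderiv ℝ φ x (A x) with hJ
  have hpos : 0 < -J / (2 * (I + 1)) := by
    apply div_pos <;> linarith
  have := key _ hpos
  have e : -J / (2 * (I + 1)) * I ≤ -J / 2 := by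
    rw [div_mul_eq_mul_div, div_le_div_iff₀ (by linarith) two_pos]
    nlinarith
  linarith

lemma young_aux {p a b : ℝ} (hp : 1 < p) (ha : 0 ≤ a) (hb : 0 ≤ b) :
    p * (a ^ (p - 1) * b) ≤ (p - 1) / 2 * a ^ p +
      p * ((p - 1) / (2 * p)) ^ (1 - p) * b ^ p := by
  set δ := (p - 1) / (2 * p) with hδ
  have hp0 : 0 < p := by linarith
  have hδ0 : 0 < δ := by apply div_pos <;> linarith
  have hpδ : p * δ = (p - 1) / 2 := by rw [hδ]; field_simp
  have mulp : ∀ c : ℝ, 0 ≤ c → c ^ (p - 1) * c = c ^ p := by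
    intro c hc
    have := Real.rpow_add_one' hc (y := p - 1) (by linarith)
    rw [← this]; congr 1; ring
  have t1 : 0 ≤ p * δ ^ (1 - p) * b ^ p := by positivity
  have t2 : 0 ≤ (p - 1) / 2 * a ^ p := by
    have : 0 ≤ p - 1 := by linarith
    positivity
  rcases le_total b (δ * a) with h | h
  · have : p * (a ^ (p - 1) * b) ≤ p * (a ^ (p - 1) * (δ * a)) := by gcongr
    have e : p * (a ^ (p - 1) * (δ * a)) = (p - 1) / 2 * a ^ p := by
      rw [← mulp a ha, ← hpδ]; ring
    linarith
  · have h' : a ≤ δ⁻¹ * b := by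
      rw [inv_mul_eq_div, le_div_iff₀ hδ0]; linarith
    have : p * (a ^ (p - 1) * b) ≤ p * ((δ⁻¹ * b) ^ (p - 1) * b) := by
      gcongr
    have e : p * ((δ⁻¹ * b) ^ (p - 1) * b) = p * δ ^ (1 - p) * b ^ p := by
      rw [Real.mul_rpow (by positivity) hb, ← mulp b hb, Real.inv_rpow hδ0.le,
        ← Real.rpow_neg hδ0.le, neg_sub]; ring
    linarith

lemma continuous_flux {E : Type*} [NormedAddCommGroup E] [NormedSpace ℝ E] {p : ℝ} (hp : 1 < p) :
    Continuous fun y : E => ‖y‖ ^ (p - 2) • y := by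
  rw [continuous_iff_continuousAt]
  intro y
  by_cases hy : y = 0
  · subst hy
    rw [ContinuousAt, smul_zero, tendsto_zero_iff_norm_tendsto_zero]
    have h1 : Continuous fun y : E => ‖y‖ ^ (p - 1) :=
      continuous_norm.rpow_const fun _ => Or.inr (by linarith)
    have h2 := h1.tendsto 0
    rw [norm_zero, Real.zero_rpow (by linarith)] at h2
    refine h2.congr fun y => ?_
    rw [norm_smul, Real.norm_of_nonneg (by positivity),
      ← Real.rpow_add_one' (norm_nonneg _) (by linarith)]
    congr 1; ring
  · exact (continuous_norm.continuousAt.rpow_const (Or.inl (norm_ne_zero_iff.2 hy))).smul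
      continuousAt_id

lemma radial_bound (N : ℕ) (hN : 1 ≤ N) (L : ℝ) (hL : 1 ≤ L) (f : ℝ → ℝ)
    (hf : f = (Set.Iic (Real.exp L)).indicator (fun r => ((√(1 + r ^ 2))⁻¹) ^ N)) :
    Integrable (fun x : EuclideanSpace ℝ (Fin N) => f ‖x‖) ∧
    ∫ x : EuclideanSpace ℝ (Fin N), f ‖x‖ ≤
      N * (volume.real (ball (0 : EuclideanSpace ℝ (Fin N)) 1)) * (4 * L) := by
  have : Nonempty (Fin N) := ⟨⟨0, hN⟩⟩
  have hc : Continuous fun r : ℝ => ((√(1 + r ^ 2))⁻¹) ^ N := by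
    refine Continuous.pow (Continuous.inv₀ (by fun_prop) fun r => ?_) _
    have : 0 < 1 + r ^ 2 := by positivity
    positivity
  have hnn : ∀ r, 0 ≤ f r := by
    intro r; rw [hf]; exact Set.indicator_nonneg (fun _ _ => by positivity) _
  constructor
  · have : (fun x : EuclideanSpace ℝ (Fin N) => f ‖x‖) =
        (closedBall 0 (Real.exp L)).indicator (fun x => ((√(1 + ‖x‖ ^ 2))⁻¹) ^ N) := by
      ext x
      rw [hf]
      simp [Set.indicator]
    rw [this, integrable_indicator_iff measurableSet_closedBall]
    exact (hc.comp continuous_norm).continuousOn.integrableOn_compact (isCompact_closedBall _ _)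
  · rw [integral_fun_norm_addHaar, finrank_euclideanSpace_fin, nsmul_eq_mul, smul_eq_mul, mul_assoc]
    gcongr
    have hle : ∫ y in Set.Ioi (0:ℝ), y ^ (N - 1) • f y ≤
        ∫ y in Set.Ioi (0:ℝ), (Set.Ioc 0 (Real.exp L)).indicator (fun y => 2 * (1 + y)⁻¹) y := by
      refine integral_mono_of_nonneg ?_ ?_ ?_
      · filter_upwards [ae_restrict_mem measurableSet_Ioi] with y hy
        have : 0 ≤ y := le_of_lt hy
        have := hnn y
        simp only [Pi.zero_apply, smul_eq_mul]
        positivity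
      · apply Integrable.restrict
        rw [integrable_indicator_iff measurableSet_Ioc]
        refine IntegrableOn.mono_set ?_ Set.Ioc_subset_Icc_self
        refine ContinuousOn.integrableOn_compact isCompact_Icc ?_
        refine continuousOn_const.mul (ContinuousOn.inv₀ (by fun_prop) fun y hy => ?_)
        have := hy.1
        positivity
      · filter_upwards [ae_restrict_mem measurableSet_Ioi] with y hy
        have hy : 0 < y := hy
        rw [hf]
        by_cases hyL : y ≤ Real.exp L
        · rw [Set.indicator_of_mem (show y ∈ Set.Iic _ from hyL), Set.indicator_of_mem (show y ∈ Set.Ioc 0 _ from ⟨hy, hyL⟩)]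
          obtain ⟨n, rfl⟩ : ∃ n, N = n + 1 := ⟨N - 1, by omega⟩
          set s := √(1 + y ^ 2) with hs
          have hs0 : 0 < s := by positivity
          have hsq : s ^ 2 = 1 + y ^ 2 := Real.sq_sqrt (by positivity)
          have h1 : y ≤ s := by nlinarith
          have h2 : 1 + y ≤ 2 * s := by nlinarith
          simp only [Nat.add_sub_cancel, smul_eq_mul]
          calc y ^ n * (s⁻¹) ^ (n + 1) = (y / s) ^ n * s⁻¹ := by
                rw [div_pow, pow_succ, inv_pow]; ring
            _ ≤ 1 * s⁻¹ := by
                gcongr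
                exact pow_le_one₀ (by positivity) ((div_le_one hs0).2 h1)
            _ ≤ 2 * (1 + y)⁻¹ := by
                rw [one_mul, ← div_eq_mul_inv, inv_eq_one_div, div_le_div_iff₀ hs0 (by positivity)]
                linarith
        · rw [Set.indicator_of_notMem (show y ∉ Set.Iic _ from hyL),
            Set.indicator_of_notMem (fun h => hyL h.2)]
          simp
    refine hle.trans ?_
    rw [setIntegral_indicator measurableSet_Ioc,
      Set.inter_eq_self_of_subset_right (fun y hy => hy.1), ← intervalIntegral.integral_of_le
      (Real.exp_pos L).le]
    have hftc : ∫ y in (0:ℝ)..(Real.exp L), 2 * (1 + y)⁻¹ =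
        2 * Real.log (1 + Real.exp L) - 2 * Real.log (1 + 0) := by
      refine intervalIntegral.integral_eq_sub_of_hasDerivAt (f := fun y => 2 * Real.log (1 + y))
        (fun y hy => ?_) ?_
      · rw [Set.uIcc_of_le (Real.exp_pos L).le] at hy
        have : (0:ℝ) < 1 + y := by linarith [hy.1]
        have h := (((hasDerivAt_id y).const_add 1).log this.ne').const_mul 2
        simpa using h
      · apply ContinuousOn.intervalIntegrable
        rw [Set.uIcc_of_le (Real.exp_pos L).le]
        refine continuousOn_const.mul (ContinuousOn.inv₀ (by fun_prop) fun y hy => ?_)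
        have := hy.1
        positivity
    rw [hftc]
    have h1 : Real.log (1 + Real.exp L) ≤ L + 1 := by
      rw [Real.log_le_iff_le_exp (by positivity), Real.exp_add]
      have := Real.add_one_le_exp (1:ℝ)
      have h2 := Real.one_le_exp (show 0 ≤ L by linarith)
      nlinarith
    simp
    linarith

lemma cutoff (N : ℕ) (hN : 1 ≤ N) (p : ℝ) (hp : 1 < p) (hNp : (N : ℝ) ≤ p) (R ε : ℝ)
    (hε : 0 < ε) :
    ∃ η : EuclideanSpace ℝ (Fin N) → ℝ, ContDiff ℝ 1 η ∧ HasCompactSupport η ∧ (∀ x, 0 ≤ η x) ∧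
      (∀ x, ‖x‖ ≤ R → η x = 1) ∧ ∫ x, ‖fderiv ℝ η x‖ ^ p ≤ ε := by
  let f : ContDiffBump (0 : ℝ) := ⟨1, 2, one_pos, one_lt_two⟩
  have hfsm : ContDiff ℝ 1 f := f.contDiff
  have hdc : Continuous (deriv f) := hfsm.continuous_deriv le_rfl
  obtain ⟨M, hM⟩ := hdc.bounded_above_of_compact_support f.hasCompactSupport.deriv
  have hM0 : 0 ≤ M := (norm_nonneg _).trans (hM 0)
  have hd0 : ∀ t : ℝ, 2 < |t| → deriv f t = 0 := by
    intro t ht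
    by_contra hne
    have h1 : t ∈ tsupport f := support_deriv_subset hne
    rw [f.tsupport_eq, mem_closedBall_zero_iff, Real.norm_eq_abs] at h1
    have : f.rOut = 2 := rfl
    linarith
  set c : ℝ := N * (volume.real (ball (0 : EuclideanSpace ℝ (Fin N)) 1)) with hc
  have hc0 : 0 ≤ c := by positivity
  -- choice of `L`
  obtain ⟨L, hL1, hLR, hLε⟩ : ∃ L : ℝ, 1 ≤ L ∧ Real.log (1 + R ^ 2) ≤ L ∧
      (2 * M) ^ p * (c * 4) * L ^ (-(p - 1)) ≤ ε := by
    have h1 := (tendsto_rpow_neg_atTop (show 0 < p - 1 by linarith)).const_mul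
      ((2 * M) ^ p * (c * 4))
    rw [mul_zero] at h1
    have h2 := h1.eventually_le_const hε
    obtain ⟨L, a, b, d⟩ := ((Filter.eventually_ge_atTop (1:ℝ)).and
      ((Filter.eventually_ge_atTop (Real.log (1 + R ^ 2))).and h2)).exists
    exact ⟨L, a, b, d⟩
  have hL0 : 0 < L := by linarith
  let t : EuclideanSpace ℝ (Fin N) → ℝ := fun x => Real.log (1 + ‖x‖ ^ 2) / L
  have hpos : ∀ x : EuclideanSpace ℝ (Fin N), 0 < 1 + ‖x‖ ^ 2 := fun x => by positivity
  have ht : ContDiff ℝ 1 t :=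
    ((contDiff_const.add (contDiff_norm_sq ℝ)).log fun x => (hpos x).ne').div_const L
  have htnn : ∀ x, 0 ≤ t x := fun x =>
    div_nonneg (Real.log_nonneg (by nlinarith [sq_nonneg ‖x‖])) hL0.le
  have htL : ∀ x : EuclideanSpace ℝ (Fin N), Real.exp L < ‖x‖ → 2 < t x := by
    intro x hx
    rw [lt_div_iff₀ hL0, Real.lt_log_iff_exp_lt (hpos x), two_mul, Real.exp_add]
    nlinarith [Real.exp_pos L]
  have htd : ∀ x, ‖fderiv ℝ t x‖ ≤ 2 / L * (√(1 + ‖x‖ ^ 2))⁻¹ := by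
    intro x
    have h1 : HasFDerivAt t (L⁻¹ • ((1 + ‖x‖ ^ 2)⁻¹ • (2 • (innerSL ℝ x)))) x := by
      have h0 : HasFDerivAt (fun x : EuclideanSpace ℝ (Fin N) => 1 + ‖x‖ ^ 2)
          (2 • (innerSL ℝ x)) x := (hasStrictFDerivAt_norm_sq x).hasFDerivAt.const_add 1
      have := (h0.log (hpos x).ne').const_mul L⁻¹
      simpa [t, div_eq_inv_mul] using this
    rw [h1.fderiv, norm_smul, norm_smul, ← Nat.cast_smul_eq_nsmul ℝ, norm_smul, innerSL_apply_norm]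
    rw [Real.norm_of_nonneg (by positivity), Real.norm_of_nonneg (by have := hpos x; positivity)]
    set s := √(1 + ‖x‖ ^ 2) with hs
    have hs0 : 0 < s := by have := hpos x; positivity
    have hsq : s ^ 2 = 1 + ‖x‖ ^ 2 := Real.sq_sqrt (by positivity)
    have hxs : ‖x‖ ≤ s := by nlinarith [norm_nonneg x]
    rw [← hsq]
    simp only [Nat.cast_ofNat, Real.norm_ofNat]
    have : (s ^ 2)⁻¹ * ‖x‖ ≤ s⁻¹ := by
      calc (s ^ 2)⁻¹ * ‖x‖ ≤ (s ^ 2)⁻¹ * s := by gcongr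
        _ = s⁻¹ := by field_simp
    calc L⁻¹ * ((s ^ 2)⁻¹ * (2 * ‖x‖)) = 2 / L * ((s ^ 2)⁻¹ * ‖x‖) := by ring
      _ ≤ _ := by gcongr
  refine ⟨fun x => f (t x), hfsm.comp ht, ?_, fun x => f.nonneg, ?_, ?_⟩
  · refine HasCompactSupport.of_support_subset_isCompact
      (isCompact_closedBall (0 : EuclideanSpace ℝ (Fin N)) (Real.exp L)) fun x hx => ?_
    by_contra hne
    rw [mem_closedBall_zero_iff, not_le] at hne
    refine hx (f.zero_of_le_dist ?_)
    rw [Real.dist_eq, sub_zero, abs_of_nonneg (htnn x)]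
    exact (htL x hne).le
  · intro x hx
    refine f.one_of_mem_closedBall ?_
    rw [mem_closedBall_zero_iff, Real.norm_of_nonneg (htnn x)]
    change t x ≤ 1
    rw [div_le_one hL0]
    refine le_trans ?_ hLR
    refine Real.log_le_log (hpos x) ?_
    have := norm_nonneg x
    gcongr
  · set g : ℝ → ℝ := (Set.Iic (Real.exp L)).indicator (fun r => ((√(1 + r ^ 2))⁻¹) ^ N) with hg
    obtain ⟨hgi, hgb⟩ := radial_bound N hN L hL1 g hg
    have hpt : ∀ x, ‖fderiv ℝ (fun x => f (t x)) x‖ ^ p ≤ (2 * M / L) ^ p * g ‖x‖ := by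
      intro x
      have hfd : fderiv ℝ (fun x => f (t x)) x = deriv f (t x) • fderiv ℝ t x := by
        exact (((hfsm.differentiable one_ne_zero) (t x)).hasDerivAt.comp_hasFDerivAt x
          ((ht.differentiable one_ne_zero) x).hasFDerivAt).fderiv
      rw [hfd, norm_smul]
      by_cases hx : ‖x‖ ≤ Real.exp L
      · rw [hg, Set.indicator_of_mem (show ‖x‖ ∈ Set.Iic _ from hx)]
        set s := √(1 + ‖x‖ ^ 2) with hs
        have hs1 : 1 ≤ s := by
          rw [hs, Real.one_le_sqrt]; nlinarith [sq_nonneg ‖x‖]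
        calc (‖deriv f (t x)‖ * ‖fderiv ℝ t x‖) ^ p ≤ (M * (2 / L * s⁻¹)) ^ p := by
              gcongr
              · exact hM _
              · exact htd x
          _ = (2 * M / L) ^ p * (s⁻¹) ^ p := by
              rw [← Real.mul_rpow (by positivity) (by positivity)]; congr 1; ring
          _ ≤ (2 * M / L) ^ p * (s⁻¹) ^ (N : ℝ) := by
              refine mul_le_mul_of_nonneg_left ?_ (by positivity)
              exact Real.rpow_le_rpow_of_exponent_ge (by positivity) (inv_le_one_of_one_le₀ hs1) hNp
          _ = _ := by rw [Real.rpow_natCast]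
      · rw [hg, Set.indicator_of_notMem (show ‖x‖ ∉ Set.Iic _ from hx), hd0 (t x), norm_zero,
          zero_mul, mul_zero, Real.zero_rpow (by linarith)]
        rw [abs_of_nonneg (htnn x)]
        exact htL x (not_le.1 hx)
    calc ∫ x, ‖fderiv ℝ (fun x => f (t x)) x‖ ^ p ≤ ∫ x, (2 * M / L) ^ p * g ‖x‖ :=
          integral_mono_of_nonneg (Filter.Eventually.of_forall fun x => by positivity)
            (hgi.const_mul _) (Filter.Eventually.of_forall hpt)
      _ = (2 * M / L) ^ p * ∫ x : EuclideanSpace ℝ (Fin N), g ‖x‖ := integral_const_mul _ _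
      _ ≤ (2 * M / L) ^ p * (c * (4 * L)) := by gcongr
      _ = (2 * M) ^ p * (c * 4) * L ^ (-(p - 1)) := by
          rw [Real.div_rpow (by positivity) hL0.le, neg_sub, Real.rpow_sub hL0, Real.rpow_one]
          ring
      _ ≤ ε := hLε

lemma energy {N : ℕ} {p : ℝ} (hp : 1 < p)
    (u : EuclideanSpace ℝ (Fin N) → ℝ)
    (hu : ContDiff ℝ 1 u) (hu_nonneg : ∀ x, 0 ≤ u x)
    (H : ∀ φ : EuclideanSpace ℝ (Fin N) → ℝ,
      ContDiff ℝ (⊤ : ℕ∞) φ → HasCompactSupport φ → (∀ x, 0 ≤ φ x) →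
      0 ≤ ∫ x, ‖gradient u x‖ ^ (p - 2) * ⟪gradient u x, gradient φ x⟫)
    (η : EuclideanSpace ℝ (Fin N) → ℝ) (h1 : ContDiff ℝ 1 η) (h2 : HasCompactSupport η)
    (h3 : ∀ x, 0 ≤ η x) :
    Integrable (fun x => (η x * (‖gradient u x‖ / (u x + 1))) ^ p) ∧
    (p - 1) / 2 * ∫ x, (η x * (‖gradient u x‖ / (u x + 1))) ^ p ≤
      p * ((p - 1) / (2 * p)) ^ (1 - p) * ∫ x, ‖fderiv ℝ η x‖ ^ p := by
  have hgc : Continuous (gradient u) :=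
    (InnerProductSpace.toDual ℝ _).symm.continuous.comp (hu.continuous_fderiv one_ne_zero)
  have hv : ∀ x, 0 < u x + 1 := fun x => by linarith [hu_nonneg x]
  have hp0 : 0 < p := by linarith
  set A : EuclideanSpace ℝ (Fin N) → EuclideanSpace ℝ (Fin N) :=
    fun x => ‖gradient u x‖ ^ (p - 2) • gradient u x with hA
  have hAc : Continuous A := (continuous_flux hp).comp hgc
  have hgrad : ∀ (φ : EuclideanSpace ℝ (Fin N) → ℝ) x y, fderiv ℝ φ x y = ⟪y, gradient φ x⟫ := by
    intro φ x y
    rw [← toDual_gradient, InnerProductSpace.toDual_apply_apply, real_inner_comm]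
  have hW := weak_C1 A hAc (fun φ a b c => by
    have := H φ a b c
    simp only [hgrad, hA, real_inner_smul_left]
    exact this)
  have hφ1 : ContDiff ℝ 1 fun x => η x ^ p * (u x + 1) ^ (1 - p) := by
    refine ContDiff.mul ?_ ?_
    · exact_mod_cast ContDiff.rpow_const_of_le (m := 1) (by exact_mod_cast h1)
        (by simpa using hp.le)
    · exact (hu.add contDiff_const).rpow_const_of_ne fun x => (hv x).ne'
  have hφ2 : HasCompactSupport fun x => η x ^ p * (u x + 1) ^ (1 - p) := by
    refine h2.mono fun x hx h0 => hx ?_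
    simp only [h0, Real.zero_rpow hp0.ne', zero_mul]
  have hφ3 : ∀ x, 0 ≤ η x ^ p * (u x + 1) ^ (1 - p) := fun x => by
    have := hv x; have := h3 x; positivity
  have hW := hW _ hφ1 hφ2 hφ3
  have hpt : ∀ x, fderiv ℝ (fun x => η x ^ p * (u x + 1) ^ (1 - p)) x (A x) ≤
      -((p - 1) / 2 * (η x * (‖gradient u x‖ / (u x + 1))) ^ p) +
        p * ((p - 1) / (2 * p)) ^ (1 - p) * ‖fderiv ℝ η x‖ ^ p := by
    intro x
    have d1 : HasFDerivAt (fun x => η x ^ p) ((p * η x ^ (p - 1)) • fderiv ℝ η x) x :=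
      ((h1.differentiable one_ne_zero) x).hasFDerivAt.rpow_const (Or.inr hp.le)
    have d2 : HasFDerivAt (fun x => (u x + 1) ^ (1 - p))
        (((1 - p) * (u x + 1) ^ (1 - p - 1)) • fderiv ℝ u x) x :=
      (((hu.differentiable one_ne_zero) x).hasFDerivAt.add_const 1).rpow_const
        (Or.inl (hv x).ne')
    have d3 := (d1.mul d2).fderiv
    have d4 : (fun x => η x ^ p * (u x + 1) ^ (1 - p)) =
        (fun x => η x ^ p) * fun x => (u x + 1) ^ (1 - p) := rfl
    rw [d4, d3]
    set G := ‖gradient u x‖ with hG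
    have hG0 : 0 ≤ G := norm_nonneg _
    set v := u x + 1 with hvd
    have hv0 : 0 < v := hv x
    have hη0 := h3 x
    have hnA : ‖A x‖ = G ^ (p - 1) := by
      simp only [hA]
      rw [norm_smul, Real.norm_of_nonneg (by positivity),
        ← Real.rpow_add_one' (norm_nonneg _) (by linarith)]
      congr 1; ring
    have hDu : fderiv ℝ u x (A x) = G ^ p := by
      rw [hgrad, hA]
      simp only
      rw [real_inner_smul_left, real_inner_self_eq_norm_sq, ← hG, ← Real.rpow_natCast G 2,
        ← Real.rpow_add' hG0 (by push_cast; linarith)]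
      congr 1; push_cast; ring
    have hDη : fderiv ℝ η x (A x) ≤ G ^ (p - 1) * ‖fderiv ℝ η x‖ := by
      refine (Real.le_norm_self _).trans ((ContinuousLinearMap.le_opNorm _ _).trans ?_)
      rw [hnA, mul_comm]
    simp only [ContinuousLinearMap.add_apply, ContinuousLinearMap.smul_apply, smul_eq_mul, hDu]
    have hy := young_aux hp (a := η x * (G / v)) (b := ‖fderiv ℝ η x‖) (by positivity)
      (norm_nonneg _)
    have e1 : (η x * (G / v)) ^ p = η x ^ p * G ^ p * v ^ (1 - p - 1) := by
      rw [Real.mul_rpow hη0 (by positivity), Real.div_rpow hG0 hv0.le,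
        show 1 - p - 1 = -p by ring, Real.rpow_neg hv0.le]; ring
    have e2 : (η x * (G / v)) ^ (p - 1) = η x ^ (p - 1) * G ^ (p - 1) * v ^ (1 - p) := by
      rw [Real.mul_rpow hη0 (by positivity), Real.div_rpow hG0 hv0.le,
        show 1 - p = -(p - 1) by ring, Real.rpow_neg hv0.le]; ring
    have e3 : v ^ (1 - p) * (p * η x ^ (p - 1) * fderiv ℝ η x (A x)) ≤
        v ^ (1 - p) * (p * η x ^ (p - 1) * (G ^ (p - 1) * ‖fderiv ℝ η x‖)) := by gcongr
    have e4 : v ^ (1 - p) * (p * η x ^ (p - 1) * (G ^ (p - 1) * ‖fderiv ℝ η x‖)) =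
        p * ((η x * (G / v)) ^ (p - 1) * ‖fderiv ℝ η x‖) := by rw [e2]; ring
    have e5 : η x ^ p * ((1 - p) * v ^ (1 - p - 1) * G ^ p) =
        -((p - 1) * (η x * (G / v)) ^ p) := by rw [e1]; ring
    linarith
  have i1 : Integrable (fun x => (η x * (‖gradient u x‖ / (u x + 1))) ^ p) := by
    refine Continuous.integrable_of_hasCompactSupport ?_ ?_
    · refine Continuous.rpow_const ?_ fun x => Or.inr hp0.le
      exact h1.continuous.mul (hgc.norm.div (hu.continuous.add continuous_const)
        fun x => (hv x).ne')
    · refine h2.mono fun x hx h0 => hx ?_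
      simp only [h0, zero_mul, Real.zero_rpow hp0.ne']
  have i2 : Integrable (fun x => ‖fderiv ℝ η x‖ ^ p) := by
    refine Continuous.integrable_of_hasCompactSupport ?_ ?_
    · exact (h1.continuous_fderiv one_ne_zero).norm.rpow_const fun x => Or.inr hp0.le
    · refine (h2.fderiv (𝕜 := ℝ)).mono fun x hx h0 => hx ?_
      simp only [h0, norm_zero, Real.zero_rpow hp0.ne']
  refine ⟨i1, ?_⟩
  have i3 : Integrable (fun x => fderiv ℝ (fun x => η x ^ p * (u x + 1) ^ (1 - p)) x (A x)) := by
    refine Continuous.integrable_of_hasCompactSupport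
      ((hφ1.continuous_fderiv one_ne_zero).clm_apply hAc) ?_
    exact (hφ2.fderiv (𝕜 := ℝ)).mono fun x hx h0 => hx (by simp only [h0]; rfl)
  have i4 := (i1.const_mul ((p - 1) / 2)).neg
  have i5 := i2.const_mul (p * ((p - 1) / (2 * p)) ^ (1 - p))
  have := integral_mono i3 (i4.add i5) hpt
  have e := integral_add i4 i5
  simp only [Pi.add_apply, Pi.neg_apply] at this e
  rw [e, integral_neg, integral_const_mul, integral_const_mul] at this
  linarith

/-- For `N ≤ p`, any `q > 0` and any nonnegative continuous `h ≢ 0`, a nonnegative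
weak solution of `-Δ_p u ≥ h u^q` in `ℝ^N` vanishes identically. -/
theorem liouville_low_dim_semilinear
    (N : ℕ) (hN : 1 ≤ N) (p q : ℝ) (hp : 1 < p) (hNp : (N : ℝ) ≤ p) (hq : 0 < q)
    (h : EuclideanSpace ℝ (Fin N) → ℝ)
    (hh_cont : Continuous h) (hh_nonneg : ∀ x, 0 ≤ h x)
    (hh_ne : ∃ x, h x ≠ 0)
    (u : EuclideanSpace ℝ (Fin N) → ℝ)
    (hu : ContDiff ℝ 1 u) (hu_nonneg : ∀ x, 0 ≤ u x)
    (hweak : ∀ φ : EuclideanSpace ℝ (Fin N) → ℝ,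
      ContDiff ℝ (⊤ : ℕ∞) φ → HasCompactSupport φ → (∀ x, 0 ≤ φ x) →
      ∫ x, h x * u x ^ q * φ x ≤
        ∫ x, ‖gradient u x‖ ^ (p - 2) * ⟪gradient u x, gradient φ x⟫) :
    ∀ x, u x = 0 := by
  have hgc : Continuous (gradient u) :=
    (InnerProductSpace.toDual ℝ _).symm.continuous.comp (hu.continuous_fderiv one_ne_zero)
  have hv : ∀ x, 0 < u x + 1 := fun x => by linarith [hu_nonneg x]
  have hp0 : 0 < p := by linarith
  have H : ∀ φ : EuclideanSpace ℝ (Fin N) → ℝ,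
      ContDiff ℝ (⊤ : ℕ∞) φ → HasCompactSupport φ → (∀ x, 0 ≤ φ x) →
      0 ≤ ∫ x, ‖gradient u x‖ ^ (p - 2) * ⟪gradient u x, gradient φ x⟫ := by
    intro φ a b c
    refine le_trans (integral_nonneg fun x => ?_) (hweak φ a b c)
    exact mul_nonneg (mul_nonneg (hh_nonneg x) (Real.rpow_nonneg (hu_nonneg x) q)) (c x)
  have hg0 : ∀ x, gradient u x = 0 := by
    intro x₀
    by_contra hne
    let ζ : ContDiffBump x₀ := ⟨1, 2, one_pos, one_lt_two⟩
    set g : EuclideanSpace ℝ (Fin N) → ℝ := fun x => ζ x * (‖gradient u x‖ / (u x + 1)) ^ p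
      with hg
    have hgcont : Continuous g := ζ.continuous.mul (Continuous.rpow_const
      (hgc.norm.div (hu.continuous.add continuous_const) fun x => (hv x).ne')
      fun x => Or.inr hp0.le)
    have hgcs : HasCompactSupport g := ζ.hasCompactSupport.mul_right
    have hgnn : ∀ x, 0 ≤ g x := fun x => mul_nonneg ζ.nonneg
      (Real.rpow_nonneg (div_nonneg (norm_nonneg _) (hv x).le) _)
    have hgx : g x₀ ≠ 0 := by
      have h1 : ζ x₀ = 1 := ζ.one_of_mem_closedBall (mem_closedBall_self zero_le_one)
      have h2 : 0 < ‖gradient u x₀‖ / (u x₀ + 1) := div_pos (norm_pos_iff.2 hne) (hv x₀)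
      simp only [hg, h1, one_mul]
      positivity
    have hpos : 0 < ∫ x, g x :=
      hgcont.integral_pos_of_hasCompactSupport_nonneg_nonzero hgcs hgnn hgx
    set C := p * ((p - 1) / (2 * p)) ^ (1 - p) with hC
    have hC0 : 0 < C := by
      have : 0 < p - 1 := by linarith
      positivity
    have hpm : 0 < (p - 1) / 2 := by linarith
    obtain ⟨η, a1, a2, a3, a4, a5⟩ := cutoff N hN p hp hNp (‖x₀‖ + 2)
      ((p - 1) / 2 * (∫ x, g x) / (2 * C)) (by positivity)
    obtain ⟨b1, b2⟩ := energy hp u hu hu_nonneg H η a1 a2 a3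
    have hle : ∫ x, g x ≤ ∫ x, (η x * (‖gradient u x‖ / (u x + 1))) ^ p := by
      refine integral_mono (hgcont.integrable_of_hasCompactSupport hgcs) b1 fun x => ?_
      have hw : 0 ≤ ‖gradient u x‖ / (u x + 1) := div_nonneg (norm_nonneg _) (hv x).le
      by_cases hx : x ∈ ball x₀ 2
      · have : η x = 1 := by
          apply a4
          rw [mem_ball, dist_eq_norm] at hx
          have := norm_sub_norm_le x x₀
          linarith
        simp only [hg, this, one_mul]
        exact mul_le_of_le_one_left (Real.rpow_nonneg hw _) ζ.le_one
      · have : ζ x = 0 := ζ.zero_of_le_dist (by simpa using hx)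
        simp only [hg, this, zero_mul]
        exact Real.rpow_nonneg (mul_nonneg (a3 x) hw) _
    have h5 : (p - 1) / 2 * (∫ x, g x) ≤ C * ((p - 1) / 2 * (∫ x, g x) / (2 * C)) :=
      (mul_le_mul_of_nonneg_left hle hpm.le).trans
        (b2.trans (mul_le_mul_of_nonneg_left a5 hC0.le))
    have h6 : C * ((p - 1) / 2 * (∫ x, g x) / (2 * C)) = (p - 1) / 2 * (∫ x, g x) / 2 := by
      field_simp
    have h7 : 0 < (p - 1) / 2 * (∫ x, g x) := mul_pos hpm hpos
    linarith
  have hfd : ∀ x, fderiv ℝ u x = 0 := by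
    intro x
    rw [← toDual_gradient, hg0, map_zero]
  intro x
  by_contra hux
  obtain ⟨x₀, hx₀⟩ := hh_ne
  let ζ : ContDiffBump x₀ := ⟨1, 2, one_pos, one_lt_two⟩
  have hw := hweak ζ ζ.contDiff ζ.hasCompactSupport fun _ => ζ.nonneg
  simp only [hg0, inner_zero_left, mul_zero, integral_zero] at hw
  have hcu : ∀ y, u y = u x := fun y =>
    is_const_of_fderiv_eq_zero (hu.differentiable one_ne_zero) hfd y x
  have hpos : 0 < ∫ y, h y * u y ^ q * ζ y := by
    refine Continuous.integral_pos_of_hasCompactSupport_nonneg_nonzero (x := x₀) ?_ ?_ ?_ ?_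
    · exact (hh_cont.mul (hu.continuous.rpow_const fun _ => Or.inr hq.le)).mul ζ.continuous
    · exact ζ.hasCompactSupport.mul_left
    · exact fun y => mul_nonneg (mul_nonneg (hh_nonneg y) (Real.rpow_nonneg (hu_nonneg y) q))
        ζ.nonneg
    · have h1 : ζ x₀ = 1 := ζ.one_of_mem_closedBall (mem_closedBall_self zero_le_one)
      have h2 : 0 < u x := lt_of_le_of_ne (hu_nonneg x) (Ne.symm hux)
      rw [h1, hcu x₀, mul_one]
      exact mul_ne_zero hx₀ (Real.rpow_pos_of_pos h2 q).ne'
  linarith
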